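/- Let g ∈ G be a p-regular element with conjugacy class C and centralizer C_G(g). The map sending a C_G(g)-conjugacy class D of p-elements of C_G(g) to the G-conjugacy class containing gD is a bijection from the set of C_G(g)-conjugacy classes of p-elements of C_G(g) onto the set of G-conjugacy classes contained in the p'-section S_{p'}(C). In particular, the number of G-conjugacy classes contained in S_{p'}(C) equals the number of C_G(g)-conjugacy classes of p-elements of C_G(g). -/

import Mathlib

open scoped TensorProduct Classical

/-! Common definitions: the character ring of a finite group, following Bonnafé,
"On the character ring of a finite group". -/

/-- The set of characters of finite-dimensional `K`-linear representations of `G`. -/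
def charSet (K G : Type u) [Field K] [Group G] : Set (G → K) :=
  {f | ∃ V : FDRep K G, f = FDRep.character V}

/-- The character ring `R(G)` of virtual characters, i.e. the subring of the `K`-algebra of
functions `G → K` generated by the characters.  Over a splitting field of characteristic zero
this is exactly the set of `ℤ`-linear combinations of irreducible characters. -/
def charRing (K G : Type u) [Field K] [Group G] : Subring (G → K) :=
  Subring.closure (charSet K G)

/-- `g` is `p`-regular if its order is prime to `p`. -/
def IsPRegular (p : ℕ) {G : Type*} [Monoid G] (g : G) : Prop :=
  Nat.Coprime (orderOf g) p

/-- `g` is a `p`-element if its order is a power of `p`. -/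
def IsPElement (p : ℕ) {G : Type*} [Monoid G] (g : G) : Prop :=
  ∃ n : ℕ, orderOf g = p ^ n

/-- The `p'`-part `g_{p'}` of an element `g` of a finite group:  writing `orderOf g = q * m'`
with `q` the `p`-part of the order, this is `g ^ (q * u)` where `u` is the inverse of
`q` modulo `m'`; it is the unique `p`-regular power of `g` such that `g * g_{p'}⁻¹` is a
`p`-element commuting with it. -/
noncomputable def pPrimePart (p : ℕ) {G : Type*} [Group G] (g : G) : G :=
  g ^ (p ^ (orderOf g).factorization p *
      (((p : ZMod (orderOf g / p ^ (orderOf g).factorization p)) ^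
        (orderOf g).factorization p)⁻¹).val)

/-- The `p'`-section `S_{p'}(C)` of the conjugacy class `C` of `g` : the set of all
`x ∈ G` whose `p'`-part lies in the class of `g`. -/
def pSection (p : ℕ) {G : Type*} [Group G] (g : G) : Set G :=
  {x | IsConj g (pPrimePart p x)}

/-- The idempotent class function `e_C` attached to the class `C` of `g`:  the characteristic
function (with values in `K`) of the `p'`-section of `C`. -/
noncomputable def eFun (p : ℕ) (K : Type*) [Field K] {G : Type*} [Group G] (g : G) : G → K :=
  fun x => if IsConj g (pPrimePart p x) then 1 else 0

/-- The number of conjugacy classes of `G` contained in a subset `S`. -/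
noncomputable def numClassesIn {G : Type*} [Group G] (S : Set G) : ℕ :=
  Nat.card {c : ConjClasses G // c.carrier ⊆ S}

/-- The image of the localization `𝒪_𝔭` in the fraction field `K`: fractions `a / b` with
`b ∉ 𝔭`. -/
def locSet (𝒪 K : Type*) [CommRing 𝒪] [Field K] [Algebra 𝒪 K] (𝔭 : Ideal 𝒪) : Set K :=
  {x | ∃ a b : 𝒪, b ∉ 𝔭 ∧ x * algebraMap 𝒪 K b = algebraMap 𝒪 K a}

/-- `𝒪_𝔭 R(G)`: the `𝒪_𝔭`-span of the character ring inside class functions `G → K`,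
realized as the subring generated by `𝒪_𝔭`-constants and characters. -/
def locCharRing (𝒪 : Type*) (K : Type u) [CommRing 𝒪] [Field K] [Algebra 𝒪 K] (𝔭 : Ideal 𝒪)
    (G : Type u) [Group G] : Subring (G → K) :=
  Subring.closure ({f | ∃ x ∈ locSet 𝒪 K 𝔭, f = Function.const G x} ∪ charSet K G)

/-- The ideal `𝔭 · 𝒪_𝔭R(G)` of `𝒪_𝔭R(G)`, generated by the constants from `𝔭`. -/
def pConstIdeal (𝒪 : Type*) (K : Type u) [CommRing 𝒪] [Field K] [Algebra 𝒪 K] (𝔭 : Ideal 𝒪)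
    (G : Type u) [Group G] : Ideal (locCharRing 𝒪 K 𝔭 G) :=
  Ideal.span {f | ∃ a ∈ 𝔭, (f : G → K) = Function.const G (algebraMap 𝒪 K a)}

/-- `kR(G) = k ⊗_ℤ R(G)`, realized through the canonical identification
`k ⊗_ℤ R(G) ≅ 𝒪_𝔭R(G) ⧸ 𝔭·𝒪_𝔭R(G)` (where `k = 𝒪/𝔭`). -/
abbrev kCharRing (𝒪 : Type*) (K : Type u) [CommRing 𝒪] [Field K] [Algebra 𝒪 K] (𝔭 : Ideal 𝒪)
    (G : Type u) [Group G] :=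
  locCharRing 𝒪 K 𝔭 G ⧸ pConstIdeal 𝒪 K 𝔭 G

/-- The ideal of `𝒪_𝔭R(G)` cutting out the block `R_𝔭(G, C)` with identity element the
idempotent `e : 𝒪_𝔭R(G)`, reduced mod `𝔭`:  the block `kR(G)·ē` is canonically the quotient
by `𝔭·𝒪_𝔭R(G) + (1 - e)·𝒪_𝔭R(G)`. -/
def blockIdeal (𝒪 : Type*) (K : Type u) [CommRing 𝒪] [Field K] [Algebra 𝒪 K] (𝔭 : Ideal 𝒪)
    (G : Type u) [Group G] (e : locCharRing 𝒪 K 𝔭 G) : Ideal (locCharRing 𝒪 K 𝔭 G) :=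
  pConstIdeal 𝒪 K 𝔭 G ⊔ Ideal.span {1 - e}

/-- The block `kR_𝔭(G, C) = kR(G)·ē_C` of `kR(G)`, as a (unital) `k`-algebra, realized as the
quotient of `𝒪_𝔭R(G)` by `𝔭·𝒪_𝔭R(G) + (1 - e_C)·𝒪_𝔭R(G)`. -/
abbrev blockAlg (𝒪 : Type*) (K : Type u) [CommRing 𝒪] [Field K] [Algebra 𝒪 K] (𝔭 : Ideal 𝒪)
    (G : Type u) [Group G] (e : locCharRing 𝒪 K 𝔭 G) :=
  locCharRing 𝒪 K 𝔭 G ⧸ blockIdeal 𝒪 K 𝔭 G e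

/-- The constants, as a ring morphism `𝒪 →+* 𝒪_𝔭R(G)`. -/
noncomputable def constRingHom (𝒪 : Type*) (K : Type u) [CommRing 𝒪] [Field K] [Algebra 𝒪 K]
    (𝔭 : Ideal 𝒪) [𝔭.IsMaximal] (G : Type u) [Group G] : 𝒪 →+* locCharRing 𝒪 K 𝔭 G where
  toFun a := ⟨Function.const G (algebraMap 𝒪 K a),
    Subring.subset_closure (Or.inl ⟨algebraMap 𝒪 K a,
      ⟨a, 1, fun h => (Ideal.ne_top_iff_one 𝔭).mp (Ideal.IsMaximal.ne_top ‹_›) h, by simp⟩, rfl⟩)⟩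
  map_one' := Subtype.ext (funext fun g => by simp)
  map_mul' a b := Subtype.ext (funext fun g => by simp)
  map_zero' := Subtype.ext (funext fun g => by simp)
  map_add' a b := Subtype.ext (funext fun g => by simp)

/-- The structural morphism giving quotients of `𝒪_𝔭R(G)` by ideals containing
`𝔭·𝒪_𝔭R(G)` (such as `kR(G)` and its blocks) their `k = 𝒪/𝔭`-algebra structure. -/
noncomputable def kScalars (𝒪 : Type*) (K : Type u) [CommRing 𝒪] [Field K] [Algebra 𝒪 K]
    (𝔭 : Ideal 𝒪) [𝔭.IsMaximal] (G : Type u) [Group G]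
    (I : Ideal (locCharRing 𝒪 K 𝔭 G)) (hI : pConstIdeal 𝒪 K 𝔭 G ≤ I) :
    (𝒪 ⧸ 𝔭) →+* (locCharRing 𝒪 K 𝔭 G ⧸ I) :=
  Ideal.Quotient.lift 𝔭 ((Ideal.Quotient.mk I).comp (constRingHom 𝒪 K 𝔭 G))
    (fun a ha => by
      simp only [RingHom.comp_apply]
      exact Ideal.Quotient.eq_zero_iff_mem.mpr (hI (Ideal.subset_span ⟨a, ha, rfl⟩)))

/-- The `k`-algebra structure morphism of the block `kR_𝔭(G, C)`. -/
noncomputable def blockScalars (𝒪 : Type*) (K : Type u) [CommRing 𝒪] [Field K] [Algebra 𝒪 K]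
    (𝔭 : Ideal 𝒪) [𝔭.IsMaximal] (G : Type u) [Group G] (e : locCharRing 𝒪 K 𝔭 G) :
    (𝒪 ⧸ 𝔭) →+* blockAlg 𝒪 K 𝔭 G e :=
  kScalars 𝒪 K 𝔭 G (blockIdeal 𝒪 K 𝔭 G e) le_sup_left

/-- The Jacobson radical of a ring. -/
noncomputable def jacRad (A : Type*) [CommRing A] : Ideal A := (⊥ : Ideal A).jacobson

/-- The Loewy length of `A`: the least `n` with `(Rad A) ^ n = 0`. -/
noncomputable def loewyLength (A : Type*) [CommRing A] : ℕ :=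
  sInf {n : ℕ | jacRad A ^ n = ⊥}

/-- `Rad A / (Rad A)²`. -/
noncomputable abbrev radQuotient (A : Type*) [CommRing A] :=
  jacRad A ⧸ (Submodule.comap (jacRad A).subtype (jacRad A ^ 2 : Ideal A))

/-- `dim_k Rad(A)/Rad(A)²`, the `k`-vector space structure being induced by a ring morphism
`k →+* A`. -/
noncomputable def extDim (k : Type*) [CommRing k] {A : Type*} [CommRing A] (φ : k →+* A) : ℕ :=
  letI : Module k (radQuotient A) := Module.compHom _ φ
  Module.finrank k (radQuotient A)

/-- `dim_k A`, the `k`-vector space structure being induced by a ring morphism `k →+* A`. -/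
noncomputable def kDim (k : Type*) [CommRing k] {A : Type*} [CommRing A] (φ : k →+* A) : ℕ :=
  letI : Module k A := Module.compHom _ φ
  Module.finrank k A

/-- `dim_k I` for an ideal `I` of `A`, the `k`-vector space structure being induced by a ring
morphism `k →+* A`. -/
noncomputable def idealKDim (k : Type*) [CommRing k] {A : Type*} [CommRing A] (φ : k →+* A)
    (I : Ideal A) : ℕ :=
  letI : Module k I := Module.compHom _ φ
  Module.finrank k I

/-- The exponent defining the `p'`-part is `1` modulo the `p'`-part of the order. -/
theorem pPrimePart_exponent_modEq_one {p : ℕ} [Fact p.Prime] {m : ℕ} (hm : m ≠ 0) :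
    p ^ m.factorization p *
        (((p : ZMod (m / p ^ m.factorization p)) ^ m.factorization p)⁻¹).val ≡
      1 [MOD m / p ^ m.factorization p] := by
  have hcop : Nat.Coprime (p ^ m.factorization p) (m / p ^ m.factorization p) :=
    (Nat.coprime_ordCompl Fact.out hm).pow_left _
  have : NeZero (m / p ^ m.factorization p) := ⟨(Nat.ordCompl_pos p hm).ne'⟩
  rw [← ZMod.natCast_eq_natCast_iff, Nat.cast_mul, ZMod.natCast_zmod_val, ← Nat.cast_pow,
    ZMod.coe_mul_inv_eq_one _ hcop, Nat.cast_one]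

theorem pPrimePart_conj (p : ℕ) {G : Type*} [Group G] (h x : G) :
    pPrimePart p (h * x * h⁻¹) = h * pPrimePart p x * h⁻¹ := by
  have ho : orderOf (h * x * h⁻¹) = orderOf x := MulEquiv.orderOf_eq (MulAut.conj h) x
  rw [pPrimePart, pPrimePart, ho, conj_pow]

theorem IsConj.pPrimePart {p : ℕ} {G : Type*} [Group G] {x y : G} (h : IsConj x y) :
    IsConj (pPrimePart p x) (pPrimePart p y) := by
  obtain ⟨c, rfl⟩ := isConj_iff.mp h
  exact isConj_iff.mpr ⟨c, (pPrimePart_conj p c x).symm⟩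

theorem IsPElement.conj {p : ℕ} {G : Type*} [Group G] {x : G} (hx : IsPElement p x) (h : G) :
    IsPElement p (h * x * h⁻¹) := by
  obtain ⟨n, hn⟩ := hx
  exact ⟨n, (MulEquiv.orderOf_eq (MulAut.conj h) x).trans hn⟩

/-- The `p'`-part of a product of commuting `p`-regular and `p`-elements is the former. -/
theorem pPrimePart_mul_eq {p : ℕ} [Fact p.Prime] {G : Type*} [Group G] [Finite G] {g d : G}
    (hg : IsPRegular p g) (hd : IsPElement p d) (hgd : Commute g d) :
    pPrimePart p (g * d) = g := by
  have hp : p.Prime := Fact.out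
  obtain ⟨n, hn⟩ := hd
  have ho : orderOf (g * d) = orderOf g * p ^ n := by
    rw [hgd.orderOf_mul_eq_mul_orderOf_of_coprime (by rw [hn]; exact hg.pow_right n), hn]
  have hfac : (orderOf (g * d)).factorization p = n := by
    rw [ho, Nat.factorization_mul (orderOf_pos g).ne' (pow_pos hp.pos n).ne', Finsupp.add_apply,
      Nat.factorization_eq_zero_of_not_dvd ((hp.coprime_iff_not_dvd).mp hg.symm),
      hp.factorization_pow]
    simp
  have hdiv : orderOf (g * d) / p ^ n = orderOf g := by
    rw [ho, Nat.mul_div_cancel _ (pow_pos hp.pos n)]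
  have hmod := pPrimePart_exponent_modEq_one (p := p) (orderOf_pos (g * d)).ne'
  rw [pPrimePart, hgd.mul_pow]
  rw [hfac, hdiv] at hmod ⊢
  rw [pow_eq_pow_iff_modEq.mpr hmod, pow_one, pow_mul d, ← hn, pow_orderOf_eq_one, one_pow, mul_one]

theorem commute_pPrimePart (p : ℕ) {G : Type*} [Group G] (x : G) :
    Commute (pPrimePart p x) x :=
  (Commute.refl x).pow_left _

theorem isPElement_pPrimePart_inv_mul (p : ℕ) [Fact p.Prime] {G : Type*} [Group G] [Finite G]
    (x : G) : IsPElement p ((pPrimePart p x)⁻¹ * x) := by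
  have hx := (orderOf_pos x).ne'
  have hpow : pPrimePart p x ^ p ^ (orderOf x).factorization p =
      x ^ p ^ (orderOf x).factorization p := by
    rw [pPrimePart, ← pow_mul, pow_eq_pow_iff_modEq]
    have h := (pPrimePart_exponent_modEq_one (p := p) hx).mul_right'
      (p ^ (orderOf x).factorization p)
    rwa [one_mul, Nat.div_mul_cancel (Nat.ordProj_dvd _ p)] at h
  obtain ⟨k, -, hk⟩ := (Nat.dvd_prime_pow Fact.out).mp (orderOf_dvd_of_pow_eq_one
    (x := (pPrimePart p x)⁻¹ * x) (n := p ^ (orderOf x).factorization p) (by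
      rw [(commute_pPrimePart p x).inv_left.mul_pow, inv_pow, hpow, inv_mul_cancel]))
  exact ⟨k, hk⟩

/-- A map inducing a bijection between the classes meeting two conjugation-stable sets
shows that they contain equally many classes. -/
theorem numClassesIn_eq_of_map {H G : Type*} [Group H] [Group G] {S : Set H} {T : Set G}
    (f : H → G) (hS : ∀ a b, IsConj a b → a ∈ S → b ∈ S) (hT : ∀ a b, IsConj a b → a ∈ T → b ∈ T)
    (hf : ∀ a ∈ S, f a ∈ T)
    (hconj : ∀ a b, a ∈ S → b ∈ S → (IsConj a b ↔ IsConj (f a) (f b)))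
    (hsurj : ∀ x ∈ T, ∃ a ∈ S, IsConj (f a) x) :
    numClassesIn S = numClassesIn T := by
  have hmk {K : Type _} [Group K] (c : ConjClasses K) : ConjClasses.mk (Quotient.out c) = c :=
    Quotient.out_eq c
  have hout (c : {c : ConjClasses H // c.carrier ⊆ S}) : Quotient.out c.1 ∈ S :=
    c.2 (ConjClasses.mem_carrier_iff_mk_eq.mpr (hmk c.1))
  have hcls {x : G} (hx : x ∈ T) : (ConjClasses.mk x).carrier ⊆ T := fun y hy =>
    hT x y (ConjClasses.mk_eq_mk_iff_isConj.mp (ConjClasses.mem_carrier_iff_mk_eq.mp hy).symm) hx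
  refine Nat.card_eq_of_bijective
    (fun c => ⟨ConjClasses.mk (f (Quotient.out c.1)), hcls (hf _ (hout c))⟩) ⟨?_, ?_⟩
  · intro c c' h
    have h' := ConjClasses.mk_eq_mk_iff_isConj.mp (Subtype.ext_iff.mp h)
    rw [← hconj _ _ (hout c) (hout c'), ← ConjClasses.mk_eq_mk_iff_isConj, hmk, hmk] at h'
    exact Subtype.ext h'
  · rintro ⟨c, hc⟩
    obtain ⟨x, rfl⟩ := ConjClasses.exists_rep c
    obtain ⟨a, ha, hax⟩ := hsurj x (hc ConjClasses.mem_carrier_mk)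
    have haS : (ConjClasses.mk a).carrier ⊆ S := fun y hy =>
      hS a y (ConjClasses.mk_eq_mk_iff_isConj.mp (ConjClasses.mem_carrier_iff_mk_eq.mp hy).symm) ha
    refine ⟨⟨ConjClasses.mk a, haS⟩, Subtype.ext (ConjClasses.mk_eq_mk_iff_isConj.mpr ?_)⟩
    refine IsConj.trans ?_ hax
    rw [← hconj _ _ (hout ⟨_, haS⟩) ha, ← ConjClasses.mk_eq_mk_iff_isConj, hmk]

/-- Let `g ∈ G` be `p`-regular, with conjugacy class `C` and centralizer
`C_G(g)`.  The map sending the `C_G(g)`-class of a `p`-element `d` of `C_G(g)` to the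
`G`-class of `g·d` is a bijection from the conjugacy classes of `p`-elements of `C_G(g)`
onto the `G`-conjugacy classes contained in the `p'`-section `S_{p'}(C)`; in particular the
two sets of classes have the same cardinality. -/
theorem pSection_classes_biject_centralizer_pClasses
    (p : ℕ) [Fact p.Prime] {G : Type*} [Group G] [Finite G]
    (g : G) (hg : IsPRegular p g) :
    (∀ d : Subgroup.centralizer ({g} : Set G), IsPElement p (d : G) →
        g * (d : G) ∈ pSection p g) ∧
    (∀ d₁ d₂ : Subgroup.centralizer ({g} : Set G),
        IsPElement p (d₁ : G) → IsPElement p (d₂ : G) →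
        (IsConj d₁ d₂ ↔ IsConj (g * (d₁ : G)) (g * (d₂ : G)))) ∧
    (∀ x ∈ pSection p g, ∃ d : Subgroup.centralizer ({g} : Set G),
        IsPElement p (d : G) ∧ IsConj (g * (d : G)) x) ∧
    numClassesIn (pSection p g) =
      numClassesIn {d : Subgroup.centralizer ({g} : Set G) | IsPElement p (d : G)} := by
  have hcomm (d : Subgroup.centralizer ({g} : Set G)) : Commute g (d : G) :=
    (Subgroup.mem_centralizer_singleton_iff.mp d.2).symm
  have hpart (d : Subgroup.centralizer ({g} : Set G)) (hd : IsPElement p (d : G)) :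
      pPrimePart p (g * (d : G)) = g := pPrimePart_mul_eq hg hd (hcomm d)
  have hmem : ∀ d : Subgroup.centralizer ({g} : Set G), IsPElement p (d : G) →
      g * (d : G) ∈ pSection p g := by
    intro d hd
    rw [pSection, Set.mem_ofPred_eq, hpart d hd]
  have hconj : ∀ d₁ d₂ : Subgroup.centralizer ({g} : Set G),
      IsPElement p (d₁ : G) → IsPElement p (d₂ : G) →
      (IsConj d₁ d₂ ↔ IsConj (g * (d₁ : G)) (g * (d₂ : G))) := by
    intro d₁ d₂ h₁ h₂
    simp only [isConj_iff]
    constructor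
    · rintro ⟨c, rfl⟩
      refine ⟨c, ?_⟩
      rw [← mul_assoc (c : G), ← (hcomm c).eq]
      simp only [Subgroup.coe_mul, Subgroup.coe_inv, mul_assoc]
    · rintro ⟨c, hc⟩
      have hcg : c * g * c⁻¹ = g := by
        have h := pPrimePart_conj p c (g * (d₁ : G))
        rwa [hc, hpart d₁ h₁, hpart d₂ h₂, eq_comm] at h
      refine ⟨⟨c, Subgroup.mem_centralizer_singleton_iff.mpr (mul_inv_eq_iff_eq_mul.mp hcg)⟩,
        Subtype.ext (mul_left_cancel (a := g) ?_)⟩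
      calc g * (c * d₁ * c⁻¹) = c * g * c⁻¹ * (c * d₁ * c⁻¹) := by rw [hcg]
        _ = c * (g * d₁) * c⁻¹ := by group
        _ = g * d₂ := hc
  have hsurj : ∀ x ∈ pSection p g, ∃ d : Subgroup.centralizer ({g} : Set G),
      IsPElement p (d : G) ∧ IsConj (g * (d : G)) x := by
    intro x hx
    obtain ⟨h, hh⟩ := isConj_iff.mp hx
    have hy : pPrimePart p (h⁻¹ * x * h) = g := by
      have := pPrimePart_conj p h⁻¹ x
      rw [inv_inv, ← hh] at this
      rw [this]
      group
    have hgx : Commute g (h⁻¹ * x * h) := hy ▸ commute_pPrimePart p (h⁻¹ * x * h)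
    refine ⟨⟨g⁻¹ * (h⁻¹ * x * h), Subgroup.mem_centralizer_singleton_iff.mpr
      ((Commute.refl g).inv_right.mul_right hgx).symm⟩, ?_, isConj_iff.mpr ⟨h, by simp [mul_assoc]⟩⟩
    have := isPElement_pPrimePart_inv_mul p (h⁻¹ * x * h)
    rwa [hy] at this
  refine ⟨hmem, hconj, hsurj, (numClassesIn_eq_of_map
    (S := {d : Subgroup.centralizer ({g} : Set G) | IsPElement p (d : G)})
    (fun d => g * (d : G)) ?_ (fun _ _ hab ha => IsConj.trans ha hab.pPrimePart)
    hmem hconj hsurj).symm⟩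
  intro a b hab ha
  obtain ⟨c, rfl⟩ := isConj_iff.mp hab
  exact IsPElement.conj ha (c : G)
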